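/- For every integer l ≥ 2, every 4-vertex-critical graph in 𝒢_l has no K2-cut and no P3-cut. -/

import Mathlib

open SimpleGraph

variable {V : Type*}

/-- The set of internal vertices of a walk from `x` to `y`. -/
def wInterior {G : SimpleGraph V} {x y : V} (P : G.Walk x y) : Set V :=
  {a | a ∈ P.support ∧ a ≠ x ∧ a ≠ y}

/-- `P` is an induced path of `G`. -/
def IsInducedPath (G : SimpleGraph V) {x y : V} (P : G.Walk x y) : Prop :=
  P.IsPath ∧ ∀ a ∈ P.support, ∀ b ∈ P.support, G.Adj a b → s(a, b) ∈ P.edges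

/-- A hole of `G`: an induced cycle of length at least 4. -/
def IsHole (G : SimpleGraph V) {v : V} (w : G.Walk v v) : Prop :=
  w.IsCycle ∧ 4 ≤ w.length ∧
    ∀ a ∈ w.support, ∀ b ∈ w.support, G.Adj a b → s(a, b) ∈ w.edges

/-- An odd hole of `G`. -/
def IsOddHole (G : SimpleGraph V) {v : V} (w : G.Walk v v) : Prop :=
  IsHole G w ∧ Odd w.length

/-- `G` belongs to the family `𝒢ₗ`: it has girth `2l+1` and
no odd hole of length at least `2l+3`. -/
def MemGFam (G : SimpleGraph V) (l : ℕ) : Prop :=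
  G.girth = (2 * l + 1 : ℕ) ∧
    ∀ (v : V) (w : G.Walk v v), IsOddHole G w → w.length < 2 * l + 3

/-- `G` is `k`-vertex-critical. -/
def IsVertexCritical (G : SimpleGraph V) (k : ℕ) : Prop :=
  G.chromaticNumber = k ∧
    ∀ v : V, (G.induce {u | u ≠ v}).chromaticNumber < k

/-- `S` is a vertex cut of `G`: deleting `S` leaves a disconnected graph. -/
def IsVertexCut (G : SimpleGraph V) (S : Set V) : Prop :=
  ¬ (G.induce Sᶜ).Preconnected

/-- `G` has a `K2`-cut. -/
def HasK2Cut (G : SimpleGraph V) : Prop :=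
  ∃ u v : V, G.Adj u v ∧ IsVertexCut G {u, v}

/-- `G` has a `P3`-cut. -/
def HasP3Cut (G : SimpleGraph V) : Prop :=
  ∃ u v w : V, u ≠ w ∧ G.Adj u v ∧ G.Adj v w ∧ ¬ G.Adj u w ∧ IsVertexCut G {u, v, w}

/-- `G` has a 2-edge-cut: two edges whose removal disconnects the graph. -/
def Has2EdgeCut (G : SimpleGraph V) : Prop :=
  ∃ e f : Sym2 V, e ≠ f ∧ e ∈ G.edgeSet ∧ f ∈ G.edgeSet ∧
    ¬ (G.deleteEdges {e, f}).Preconnected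

/-- `Q1`, `Q2` are the two internally disjoint `(x,y)`-paths of the cycle `w`. -/
def ArcsOf (G : SimpleGraph V) {v x y : V} (w : G.Walk v v) (Q1 Q2 : G.Walk x y) : Prop :=
  x ∈ w.support ∧ y ∈ w.support ∧ x ≠ y ∧ Q1.IsPath ∧ Q2.IsPath ∧
    ({a | a ∈ Q1.support} ∩ {a | a ∈ Q2.support} = {x, y}) ∧
    ({e | e ∈ w.edges} = {e | e ∈ Q1.edges} ∪ {e | e ∈ Q2.edges})

/-- `P` is a chordal path of the hole `w`: `w ∪ P` is an induced theta-subgraph of `G`. -/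
def IsChordalPath (G : SimpleGraph V) {v x y : V} (w : G.Walk v v) (P : G.Walk x y) : Prop :=
  IsHole G w ∧ P.IsPath ∧ 2 ≤ P.length ∧ x ∈ w.support ∧ y ∈ w.support ∧ x ≠ y ∧
    (∀ a ∈ wInterior P, a ∉ w.support) ∧
    (∀ a, (a ∈ w.support ∨ a ∈ P.support) → ∀ b, (b ∈ w.support ∨ b ∈ P.support) →
      G.Adj a b → (s(a, b) ∈ w.edges ∨ s(a, b) ∈ P.edges))

/-- `P` is an `(s,t)`-jump over the hole `w`. -/
def IsJump (G : SimpleGraph V) {v s t : V} (w : G.Walk v v) (P : G.Walk s t) : Prop :=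
  IsHole G w ∧ s ∈ w.support ∧ t ∈ w.support ∧ s ≠ t ∧ ¬ G.Adj s t ∧
    IsInducedPath G P ∧ ∀ a ∈ wInterior P, a ∉ w.support

/-- `P` is a local jump over `w` across the interior of the arc `Q1`
(`Q1`, `Q2` being the two arcs of `w` between the ends of `P`). -/
def IsLocalJumpAcross (G : SimpleGraph V) {v s t : V} (w : G.Walk v v)
    (P Q1 Q2 : G.Walk s t) : Prop :=
  IsJump G w P ∧ ArcsOf G w Q1 Q2 ∧
    (∃ a ∈ wInterior Q1, ∃ b ∈ wInterior P, G.Adj a b) ∧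
    (∀ a ∈ wInterior Q2, ∀ b ∈ wInterior P, ¬ G.Adj a b)

/-- `P` is a local jump over `w`. -/
def IsLocalJump (G : SimpleGraph V) {v s t : V} (w : G.Walk v v) (P : G.Walk s t) : Prop :=
  ∃ Q1 Q2 : G.Walk s t, IsLocalJumpAcross G w P Q1 Q2

/-- `P` is a local jump over `w` across one vertex. -/
def IsLocalJumpAcrossOne (G : SimpleGraph V) {v s t : V} (w : G.Walk v v)
    (P : G.Walk s t) : Prop :=
  ∃ Q1 Q2 : G.Walk s t, IsLocalJumpAcross G w P Q1 Q2 ∧ Q1.length = 2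

/-- `P` is a short jump over `w`: no internal vertex of either arc of `w`
has a neighbour among the internal vertices of `P`. -/
def IsShortJump (G : SimpleGraph V) {v s t : V} (w : G.Walk v v) (P : G.Walk s t) : Prop :=
  IsJump G w P ∧
    ∀ a ∈ w.support, a ≠ s → a ≠ t → ∀ b ∈ wInterior P, ¬ G.Adj a b

/-- `P` is a short jump over `w` across the interior of `Q1`, i.e. `P ∪ Q1` is an
odd hole (a jump hole over `w`). -/
def IsShortJumpAcross (G : SimpleGraph V) {v s t : V} (w : G.Walk v v)
    (P Q1 Q2 : G.Walk s t) : Prop :=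
  IsShortJump G w P ∧ ArcsOf G w Q1 Q2 ∧ IsOddHole G (P.append Q1.reverse)

/-- `x` lies in some jump hole over `w`. -/
def InJumpHoleOver (G : SimpleGraph V) {v : V} (w : G.Walk v v) (x : V) : Prop :=
  ∃ (s t : V) (P Q1 Q2 : G.Walk s t),
    IsShortJumpAcross G w P Q1 Q2 ∧ (x ∈ P.support ∨ x ∈ Q1.support)

/-- `a`, `b`, `c`, `d` appear on the cycle `w` in this cyclic order. -/
def CyclicOrder4 (G : SimpleGraph V) {v : V} (w : G.Walk v v) (a b c d : V) : Prop :=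
  ∃ n : ℕ, List.Sublist [a, b, c, d] (w.support.tail.rotate n)

/-- A `K4`-subdivision in `G`: four distinct branch vertices joined by six
internally disjoint paths (the arrises). -/
structure K4Sub (G : SimpleGraph V) where
  u1 : V
  u2 : V
  u3 : V
  u4 : V
  P1 : G.Walk u1 u2
  P2 : G.Walk u3 u4
  Q1 : G.Walk u2 u3
  Q2 : G.Walk u1 u4
  L1 : G.Walk u1 u3
  L2 : G.Walk u2 u4
  hu : List.Nodup [u1, u2, u3, u4]
  hP1 : P1.IsPath
  hP2 : P2.IsPath
  hQ1 : Q1.IsPath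
  hQ2 : Q2.IsPath
  hL1 : L1.IsPath
  hL2 : L2.IsPath
  hP : ∀ a ∈ P1.support, a ∉ P2.support
  hQ : ∀ a ∈ Q1.support, a ∉ Q2.support
  hL : ∀ a ∈ L1.support, a ∉ L2.support

namespace K4Sub

variable {G : SimpleGraph V}

/-- The face cycle `C1 = P1 ∪ Q1 ∪ L1`. -/
def C1 (H : K4Sub G) : G.Walk H.u1 H.u1 := (H.P1.append H.Q1).append H.L1.reverse
/-- The face cycle `C2 = P1 ∪ Q2 ∪ L2`. -/
def C2 (H : K4Sub G) : G.Walk H.u1 H.u1 := (H.P1.append H.L2).append H.Q2.reverse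
/-- The face cycle `C3 = P2 ∪ Q1 ∪ L2`. -/
def C3 (H : K4Sub G) : G.Walk H.u2 H.u2 := (H.Q1.append H.P2).append H.L2.reverse
/-- The face cycle `C4 = C1 △ C2 △ C3 = P2 ∪ Q2 ∪ L1`. -/
def C4 (H : K4Sub G) : G.Walk H.u1 H.u1 := (H.L1.append H.P2).append H.Q2.reverse

/-- The vertex set of the subdivision. -/
def verts (H : K4Sub G) : Set V :=
  {a | a ∈ H.P1.support ∨ a ∈ H.P2.support ∨ a ∈ H.Q1.support ∨
       a ∈ H.Q2.support ∨ a ∈ H.L1.support ∨ a ∈ H.L2.support}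

/-- The edge set of the subdivision. -/
def edges (H : K4Sub G) : Set (Sym2 V) :=
  {e | e ∈ H.P1.edges ∨ e ∈ H.P2.edges ∨ e ∈ H.Q1.edges ∨
       e ∈ H.Q2.edges ∨ e ∈ H.L1.edges ∨ e ∈ H.L2.edges}

end K4Sub

/-- `H` is an odd `K4`-subdivision: all four face cycles are odd holes. -/
def IsOddK4 (G : SimpleGraph V) (H : K4Sub G) : Prop :=
  IsOddHole G H.C1 ∧ IsOddHole G H.C2 ∧ IsOddHole G H.C3 ∧ IsOddHole G H.C4

/-- `G` has an odd `K4`-subdivision. -/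
def HasOddK4 (G : SimpleGraph V) : Prop := ∃ H : K4Sub G, IsOddK4 G H

/-- `H` is a balanced `K4`-subdivision of type `(1,2)`. -/
def IsBalancedK4 (G : SimpleGraph V) (H : K4Sub G) : Prop :=
  IsOddHole G H.C1 ∧ IsOddHole G H.C2 ∧
    IsHole G H.C3 ∧ Even H.C3.length ∧ IsHole G H.C4 ∧ Even H.C4.length ∧
    H.Q1.length = 1 ∧ 2 ≤ H.L2.length

/-- `G` contains a balanced `K4`-subdivision of type `(1,2)`. -/
def HasBalancedK4 (G : SimpleGraph V) : Prop := ∃ H : K4Sub G, IsBalancedK4 G H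

/-- `P` is a direct connection linking the (vertex sets of) two disjoint induced
subgraphs `S1` and `S2`. -/
def IsDirectConnection (G : SimpleGraph V) (S1 S2 : Set V) {v1 v2 : V}
    (P : G.Walk v1 v2) : Prop :=
  IsInducedPath G P ∧ (∀ x ∈ P.support, x ∉ S1 ∧ x ∉ S2) ∧
    (∃ y ∈ S1, G.Adj v1 y) ∧ (∃ y ∈ S2, G.Adj v2 y) ∧
    (∀ x ∈ P.support, (∃ y ∈ S1, G.Adj x y) → x = v1) ∧
    (∀ x ∈ P.support, (∃ y ∈ S2, G.Adj x y) → x = v2)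

/-- `P` is a minimal direct connection linking `S1` and `S2`. -/
def IsMinimalDirectConnection (G : SimpleGraph V) (S1 S2 : Set V) {v1 v2 : V}
    (P : G.Walk v1 v2) : Prop :=
  IsDirectConnection G S1 S2 P ∧
    ∀ (w1 w2 : V) (P' : G.Walk w1 w2), IsDirectConnection G S1 S2 P' →
      (∀ x ∈ P'.support, x ∈ P.support) → ∀ x ∈ P.support, x ∈ P'.support

/-- The map `c` is a proper colouring of the subgraph of `G` induced on `X`. -/
def ProperOn {α : Type*} (G : SimpleGraph V) (X : Set V) (c : V → α) : Prop :=
  ∀ x ∈ X, ∀ y ∈ X, G.Adj x y → c x ≠ c y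

theorem IsVertexCut.exists_separation {G : SimpleGraph V} {S : Set V} (h : IsVertexCut G S) :
    ∃ X Y : Set V, (∀ x, x ∈ X ∨ x ∈ Y) ∧ X ∩ Y = S ∧ (∃ a, a ∉ X) ∧ (∃ b, b ∉ Y) ∧
      ∀ x ∉ X, ∀ y ∉ Y, ¬ G.Adj x y := by
  unfold IsVertexCut Preconnected at h
  push Not at h
  obtain ⟨a, b, hab⟩ := h
  let A : Set V := {x | ∃ hx : x ∈ Sᶜ, (G.induce Sᶜ).Reachable a ⟨x, hx⟩}
  have hAS : ∀ x ∈ A, x ∉ S := fun x hx => hx.1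
  refine ⟨Aᶜ, A ∪ S, fun x => ?_, ?_, ⟨a, ?_⟩, ⟨b, ?_⟩, ?_⟩
  · by_cases hx : x ∈ A
    · exact Or.inr (Or.inl hx)
    · exact Or.inl hx
  · ext x
    constructor
    · rintro ⟨h1, h2 | h2⟩
      · exact absurd h2 h1
      · exact h2
    · exact fun hx => ⟨fun hxA => hAS x hxA hx, Or.inr hx⟩
  · exact fun hn => hn ⟨a.2, Reachable.refl _⟩
  · rintro (⟨_, hb⟩ | hb)
    · exact hab hb
    · exact b.2 hb
  · intro x hx y hy hadj
    obtain ⟨hxS, hx⟩ := not_not.mp hx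
    have hyS : y ∈ Sᶜ := fun hyS => hy (Or.inr hyS)
    have hxy : (G.induce Sᶜ).Adj ⟨x, hxS⟩ ⟨y, hyS⟩ := hadj
    exact hy (Or.inl ⟨hyS, hx.trans hxy.reachable⟩)

theorem IsVertexCritical.exists_properOn {G : SimpleGraph V} {k : ℕ}
    (h : IsVertexCritical G (k + 1)) [NeZero k] {X : Set V} {z : V} (hz : z ∉ X) :
    ∃ c : V → Fin k, ProperOn G X c := by
  have hlt := h.2 z
  have hle : (G.induce {u | u ≠ z}).chromaticNumber ≤ (k : ℕ) := by
    push_cast at hlt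
    exact Order.le_of_lt_add_one hlt
  obtain ⟨C⟩ := chromaticNumber_le_iff_colorable.mp hle
  have hne : ∀ x ∈ X, x ≠ z := fun x hx hxz => hz (hxz ▸ hx)
  classical
  refine ⟨fun x => if hx : x ≠ z then C ⟨x, hx⟩ else 0, ?_⟩
  intro x hx y hy hadj
  have hxy : (G.induce {u | u ≠ z}).Adj ⟨x, hne x hx⟩ ⟨y, hne y hy⟩ := hadj
  simpa [hne x hx, hne y hy] using C.valid hxy

/-- Colourings of the two sides of a separation that agree on the separator, up to a
permutation of the colours, glue to a colouring of the whole graph. -/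
theorem colorable_of_separation {G : SimpleGraph V} {k : ℕ} {X Y : Set V}
    (hXY : ∀ x, x ∈ X ∨ x ∈ Y) (hsep : ∀ x ∉ X, ∀ y ∉ Y, ¬ G.Adj x y)
    {c d : V → Fin k} (hc : ProperOn G X c) (hd : ProperOn G Y d)
    (σ : Equiv.Perm (Fin k)) (hσ : ∀ x ∈ X ∩ Y, σ (d x) = c x) : G.Colorable k := by
  classical
  let e : V → Fin k := fun x => if x ∈ X then c x else σ (d x)
  have heX : ∀ x ∈ X, e x = c x := fun x hx => if_pos hx
  have heY : ∀ x ∈ Y, e x = σ (d x) := fun x hy => by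
    by_cases hx : x ∈ X
    · rw [heX x hx, hσ x ⟨hx, hy⟩]
    · exact if_neg hx
  refine ⟨Coloring.mk e fun {x y} hxy => ?_⟩
  by_cases hX : x ∈ X ∧ y ∈ X
  · rw [heX x hX.1, heX y hX.2]
    exact hc x hX.1 y hX.2 hxy
  · have hY : x ∈ Y ∧ y ∈ Y := by
      have h1 := hsep x
      have h2 := hsep y
      have h3 := hXY x
      have h4 := hXY y
      have h5 := hxy.symm
      grind
    rw [heY x hY.1, heY y hY.2]
    exact fun h => hd x hY.1 y hY.2 hxy (σ.injective h)

theorem exists_perm_fin_three {a b c d : Fin 3} (hab : a ≠ b) (hcd : c ≠ d) :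
    ∃ σ : Equiv.Perm (Fin 3), σ c = a ∧ σ d = b := by
  revert a b c d
  decide

theorem SimpleGraph.Reachable.exists_inducedPath {G : SimpleGraph V} {u w : V}
    (h : G.Reachable u w) : ∃ p : G.Walk u w, IsInducedPath G p := by
  obtain ⟨p, hp, hlen⟩ := h.exists_path_of_dist
  have key : ∀ i j, i ≤ j → j ≤ p.length → G.Adj (p.getVert i) (p.getVert j) →
      s(p.getVert i, p.getVert j) ∈ p.edges := by
    intro i j hij hj hadj
    have hd := dist_le ((p.take i).append (Walk.cons hadj (p.drop j)))
    rw [Walk.length_append, Walk.length_cons, Walk.take_length, Walk.drop_length, ← hlen] at hd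
    have hne : i ≠ j := fun hij => hadj.ne (by rw [hij])
    obtain rfl : j = i + 1 := by omega
    exact p.mk_mem_edges_iff_exists.mpr ⟨i, by omega, rfl⟩
  refine ⟨p, hp, fun a ha b hb hadj => ?_⟩
  obtain ⟨i, rfl, hi⟩ := Walk.mem_support_iff_exists_getVert.mp ha
  obtain ⟨j, rfl, hj⟩ := Walk.mem_support_iff_exists_getVert.mp hb
  rcases le_total i j with hij | hij
  · exact key i j hij hj hadj
  · rw [Sym2.eq_swap]
    exact key j i hij hi hadj.symm

theorem SimpleGraph.Walk.even_length_iff_of_avoids_color {G : SimpleGraph V} {c : V → Fin 3}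
    {k : Fin 3} (hc : ∀ x y, G.Adj x y → c x ≠ c y ∧ c x ≠ k ∧ c y ≠ k) {u w : V}
    (p : G.Walk u w) : Even p.length ↔ c u = c w := by
  induction p with
  | nil => simp
  | @cons u v w h p ih =>
    rw [Walk.length_cons, Nat.even_add_one, ih]
    have h1 := hc u v h
    by_cases hp : p.Nil
    · obtain rfl := hp.eq
      grind
    · have h2 := (hc _ _ (p.adj_penultimate hp)).2.2
      omega

/-- If every 3-colouring of `X` treats the equality of the colours of `u` and `w` the same way
as `c`, then `u` and `w` are joined by a path using only the two colours other than that of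
their common neighbour `v`. -/
theorem ProperOn.exists_kempe_path {G : SimpleGraph V} {X : Set V} {c : V → Fin 3}
    (hc : ProperOn G X c) {u v w : V} (huX : u ∈ X)
    (huv : c u ≠ c v) (hwv : c w ≠ c v)
    (hrigid : ∀ d : V → Fin 3, ProperOn G X d → (d u = d w ↔ c u = c w)) :
    ∃ p : G.Walk u w, IsInducedPath G p ∧ (∀ a ∈ p.support, a ∈ X ∧ a ≠ v) ∧
      (Even p.length ↔ c u = c w) := by
  classical
  let H : SimpleGraph V :=
    { Adj := fun x y => G.Adj x y ∧ (x ∈ X ∧ c x ≠ c v) ∧ (y ∈ X ∧ c y ≠ c v)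
      symm := ⟨fun x y h => ⟨h.1.symm, h.2.2, h.2.1⟩⟩
      loopless := ⟨fun x h => G.irrefl h.1⟩ }
  have hHG : H ≤ G := fun x y h => h.1
  have hmem : ∀ {x}, H.Reachable u x → x ∈ X ∧ c x ≠ c v := by
    rintro x ⟨p⟩
    by_cases hp : p.Nil
    · obtain rfl := hp.eq
      exact ⟨huX, huv⟩
    · exact (p.adj_penultimate hp).2.2
  have hreach : H.Reachable u w := by
    by_contra hnot
    obtain ⟨t, htu, htv⟩ : ∃ t : Fin 3, t ≠ c u ∧ t ≠ c v := by
      generalize c u = i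
      generalize c v = j
      revert i j
      decide
    have hval : ∀ s : Fin 3, s ≠ c v → s = c u ∨ s = t := by omega
    let d : V → Fin 3 := fun x => if H.Reachable u x then Equiv.swap (c u) t (c x) else c x
    have hd1 : ∀ x, H.Reachable u x → d x = Equiv.swap (c u) t (c x) := fun x hx => if_pos hx
    have hd2 : ∀ x, ¬ H.Reachable u x → d x = c x := fun x hx => if_neg hx
    have hcross : ∀ x ∈ X, ∀ y ∈ X, G.Adj x y → H.Reachable u x → ¬ H.Reachable u y →
        d x ≠ d y := by
      intro x hx y hy hadj hrx hry
      have hy' : c y = c v := by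
        by_contra hne
        have hxy : H.Adj x y := ⟨hadj, hmem hrx, hy, hne⟩
        exact hry (hrx.trans hxy.reachable)
      rw [hd1 x hrx, hd2 y hry, hy']
      rcases hval _ (hmem hrx).2 with h | h
      · rwa [h, Equiv.swap_apply_left]
      · rwa [h, Equiv.swap_apply_right]
    have hd : ProperOn G X d := by
      intro x hx y hy hadj
      by_cases hrx : H.Reachable u x <;> by_cases hry : H.Reachable u y
      · rw [hd1 x hrx, hd1 y hry]
        exact fun h => hc x hx y hy hadj ((Equiv.swap _ _).injective h)
      · exact hcross x hx y hy hadj hrx hry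
      · exact (hcross y hy x hx hadj.symm hry hrx).symm
      · rw [hd2 x hrx, hd2 y hry]
        exact hc x hx y hy hadj
    have h := hrigid d hd
    rw [hd1 u (Reachable.refl _), hd2 w hnot, Equiv.swap_apply_left] at h
    rcases hval _ hwv with hw | hw
    · exact htu ((h.mpr hw.symm).trans hw)
    · exact htu (hw.symm.trans (h.mp hw.symm).symm)
  obtain ⟨p, hp, hind⟩ := hreach.exists_inducedPath
  have hsupp : ∀ a ∈ p.support, a ∈ X ∧ c a ≠ c v := fun a ha => hmem ⟨p.takeUntil a ha⟩
  refine ⟨p.mapLe hHG, ⟨(Walk.isPath_mapLe hHG).mpr hp, ?_⟩, ?_, ?_⟩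
  · rw [Walk.support_mapLe_eq_support, Walk.edges_mapLe_eq_edges]
    exact fun a ha b hb hab => hind a ha b hb ⟨hab, hsupp a ha, hsupp b hb⟩
  · rw [Walk.support_mapLe_eq_support]
    exact fun a ha => ⟨(hsupp a ha).1, fun hav => (hsupp a ha).2 (by rw [hav])⟩
  · rw [Walk.length_mapLe]
    exact p.even_length_iff_of_avoids_color (k := c v) fun x y (h : H.Adj x y) =>
      ⟨hc x h.2.1.1 y h.2.2.1 h.1, h.2.1.2, h.2.2.2⟩

theorem SimpleGraph.Walk.IsPath.girth_le_length_add_two {G : SimpleGraph V} {u v w : V}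
    {p : G.Walk u w} (hp : p.IsPath) (hv : v ∉ p.support) (huw : u ≠ w)
    (huv : G.Adj u v) (hvw : G.Adj v w) : G.girth ≤ p.length + 2 := by
  have hq : (Walk.cons hvw p.reverse).IsPath := by
    rw [Walk.cons_isPath_iff]
    exact ⟨hp.reverse, by simpa using hv⟩
  have hcyc : (Walk.cons huv (Walk.cons hvw p.reverse)).IsCycle := by
    rw [Walk.cons_isCycle_iff]
    refine ⟨hq, ?_⟩
    rw [Walk.edges_cons, List.mem_cons, not_or]
    refine ⟨?_, fun h => hv ?_⟩
    · rw [Sym2.eq_iff]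
      rintro (⟨h, -⟩ | ⟨h, -⟩)
      · exact huv.ne h
      · exact huw h
    · simpa using Walk.snd_mem_support_of_mem_edges _ h
  simpa using girth_le_length hcyc

theorem IsInducedPath.isHole_append_reverse {G : SimpleGraph V} {u w : V} {p q : G.Walk u w}
    (hp : IsInducedPath G p) (hq : IsInducedPath G q) (hlp : 1 < p.length)
    (hlen : 4 ≤ p.length + q.length)
    (hpq : ∀ x ∈ p.support, x ∈ q.support → x = u ∨ x = w)
    (hadj : ∀ x ∈ p.support, ∀ y ∈ q.support, G.Adj x y → x = u ∨ x = w ∨ y = u ∨ y = w) :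
    IsHole G (p.append q.reverse) := by
  refine ⟨hp.1.isCycle_append hq.1.reverse ?_ (Or.inl hlp), by simpa using hlen, ?_⟩
  · intro x hx hx'
    have hu : u ∉ p.support.tail := by
      have h := hp.1.support_nodup
      rw [← Walk.cons_tail_support] at h
      exact (List.nodup_cons.mp h).1
    have hw : w ∉ q.reverse.support.tail := by
      have h := hq.1.reverse.support_nodup
      rw [← Walk.cons_tail_support] at h
      exact (List.nodup_cons.mp h).1
    have hxq : x ∈ q.support := by simpa using List.mem_of_mem_tail hx'
    rcases hpq x (List.mem_of_mem_tail hx) hxq with rfl | rfl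
    · exact hu hx
    · exact hw hx'
  · have hmix : ∀ a ∈ p.support, ∀ b ∈ q.support, G.Adj a b →
        s(a, b) ∈ p.edges ∨ s(a, b) ∈ q.edges := by
      intro a ha b hb hab
      rcases hadj a ha b hb hab with h | h | h | h
      · exact Or.inr (hq.2 a (h ▸ q.start_mem_support) b hb hab)
      · exact Or.inr (hq.2 a (h ▸ q.end_mem_support) b hb hab)
      · exact Or.inl (hp.2 a ha b (h ▸ p.start_mem_support) hab)
      · exact Or.inl (hp.2 a ha b (h ▸ p.end_mem_support) hab)
    intro a ha b hb hab
    simp only [Walk.mem_support_append_iff, Walk.support_reverse, List.mem_reverse] at ha hb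
    simp only [Walk.edges_append, Walk.edges_reverse, List.mem_append, List.mem_reverse]
    rcases ha with ha | ha <;> rcases hb with hb | hb
    · exact Or.inl (hp.2 a ha b hb hab)
    · exact hmix a ha b hb hab
    · rw [Sym2.eq_swap]
      exact hmix b hb a ha hab.symm
    · exact Or.inr (hq.2 a ha b hb hab)

theorem IsVertexCritical.not_hasK2Cut {G : SimpleGraph V} (hcrit : IsVertexCritical G 4) :
    ¬ HasK2Cut G := by
  rintro ⟨u, v, huv, hcut⟩
  obtain ⟨X, Y, hXY, hS, ⟨a, ha⟩, ⟨b, hb⟩, hsep⟩ := hcut.exists_separation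
  have hu : u ∈ X ∩ Y := by simp [hS]
  have hv : v ∈ X ∩ Y := by simp [hS]
  obtain ⟨c, hc⟩ := hcrit.exists_properOn ha
  obtain ⟨d, hd⟩ := hcrit.exists_properOn hb
  obtain ⟨σ, hσu, hσv⟩ := exists_perm_fin_three (hc u hu.1 v hv.1 huv) (hd u hu.2 v hv.2 huv)
  have hcol := colorable_of_separation hXY hsep hc hd σ (by
    rw [hS]
    rintro x (rfl | rfl)
    exacts [hσu, hσv])
  have hle := chromaticNumber_le_iff_colorable.mpr hcol
  rw [hcrit.1] at hle
  exact absurd hle (by norm_num)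

theorem IsVertexCritical.not_hasP3Cut {G : SimpleGraph V} {l : ℕ} (hl : 2 ≤ l)
    (hG : MemGFam G l) (hcrit : IsVertexCritical G 4) : ¬ HasP3Cut G := by
  rintro ⟨u, v, w, huw, huv, hvw, hnuw, hcut⟩
  obtain ⟨X, Y, hXY, hS, ⟨a, ha⟩, ⟨b, hb⟩, hsep⟩ := hcut.exists_separation
  have hu : u ∈ X ∩ Y := by simp [hS]
  have hv : v ∈ X ∩ Y := by simp [hS]
  have hw : w ∈ X ∩ Y := by simp [hS]
  have hdiff : ∀ c d : V → Fin 3, ProperOn G X c → ProperOn G Y d →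
      ¬ (c u = c w ↔ d u = d w) := by
    intro c d hc hd hiff
    have hcvw := hc v hv.1 w hw.1 hvw
    have hdvw := hd v hv.2 w hw.2 hvw
    have hcuv := hc u hu.1 v hv.1 huv
    have hduv := hd u hu.2 v hv.2 huv
    obtain ⟨σ, hσu, hσv⟩ := exists_perm_fin_three hcuv hduv
    have hσw : σ (d w) = c w := by
      have h1 : σ (d v) ≠ σ (d w) := fun h => hdvw (σ.injective h)
      have h2 : σ (d u) = σ (d w) ↔ d u = d w := σ.injective.eq_iff
      by_cases h : d u = d w
      · rw [← h, hσu, hiff.mpr h]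
      · have h3 := mt h2.mp h
        have h4 := mt hiff.mp h
        omega
    have hcol := colorable_of_separation hXY hsep hc hd σ (by
      rw [hS]
      rintro x (rfl | rfl | rfl)
      exacts [hσu, hσv, hσw])
    have hle := chromaticNumber_le_iff_colorable.mpr hcol
    rw [hcrit.1] at hle
    exact absurd hle (by norm_num)
  obtain ⟨c, hc⟩ := hcrit.exists_properOn ha
  obtain ⟨d, hd⟩ := hcrit.exists_properOn hb
  have hcd := hdiff c d hc hd
  obtain ⟨p, hp, hpX, hpe⟩ := hc.exists_kempe_path hu.1 (hc u hu.1 v hv.1 huv)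
    (hc w hw.1 v hv.1 hvw.symm) fun c' hc' => by
      have := hdiff c' d hc' hd
      tauto
  obtain ⟨q, hq, hqY, hqe⟩ := hd.exists_kempe_path hu.2 (hd u hu.2 v hv.2 huv)
    (hd w hw.2 v hv.2 hvw.symm) fun d' hd' => by
      have := hdiff c d' hc hd'
      tauto
  have hends : ∀ x ∈ X, x ∈ Y → x ≠ v → x = u ∨ x = w := by
    intro x hx hy hxv
    have hxS : x ∈ X ∩ Y := ⟨hx, hy⟩
    rw [hS] at hxS
    rcases hxS with h | h | h
    · exact Or.inl h
    · exact absurd h hxv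
    · exact Or.inr h
  have hgp := hp.1.girth_le_length_add_two (fun h => (hpX v h).2 rfl) huw huv hvw
  have hgq := hq.1.girth_le_length_add_two (fun h => (hqY v h).2 rfl) huw huv hvw
  rw [hG.1] at hgp hgq
  have hodd : Odd (p.length + q.length) := by
    rw [← Nat.not_even_iff_odd, Nat.even_add]
    tauto
  have hlen : 2 * l + 3 ≤ p.length + q.length := by
    obtain ⟨m, hm⟩ := hodd
    omega
  have hhole : IsHole G (p.append q.reverse) := by
    refine hp.isHole_append_reverse hq (by omega) (by omega)
      (fun x hx hx' => hends x (hpX x hx).1 (hqY x hx').1 (hpX x hx).2) ?_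
    intro x hx y hy hxy
    by_cases hxY : x ∈ Y
    · rcases hends x (hpX x hx).1 hxY (hpX x hx).2 with h | h
      · exact Or.inl h
      · exact Or.inr (Or.inl h)
    · have hyX : y ∈ X := by
        by_contra hyX
        exact hsep y hyX x hxY hxy.symm
      exact Or.inr (Or.inr (hends y hyX (hqY y hy).1 (hqY y hy).2))
  have hlt := hG.2 u _ ⟨hhole, by simpa using hodd⟩
  rw [Walk.length_append, Walk.length_reverse] at hlt
  omega

/-- For every integer `l ≥ 2`, every 4-vertex-critical graph in `𝒢ₗ`
has no `K2`-cut and no `P3`-cut. -/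
theorem four_critical_no_K2_or_P3_cut {V : Type*} [Fintype V]
    (l : ℕ) (hl : 2 ≤ l) (G : SimpleGraph V) (hG : MemGFam G l)
    (hcrit : IsVertexCritical G 4) :
    ¬ HasK2Cut G ∧ ¬ HasP3Cut G := by
  exact ⟨hcrit.not_hasK2Cut, hcrit.not_hasP3Cut hl hG⟩
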